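/- Let T be a tournament, S ⊆ V(T), and k a nonnegative integer such that no arc of T is contained in more than k distinct S-triangles. Let S₁ ⊆ S, S₂ = S \ S₁, let Z = {v ∈ V(T) \ S : Type(v) = S₁}, and suppose |Z| ≥ 6k + 6. Let Z' be the set of vertices of Z that have at least k+1 in-neighbors in Z and at least k+1 out-neighbors in Z. Then: (i) every arc of T with one endpoint in S₁ and the other in S₂ is directed from S₁ to S₂, and every such arc lies in no set F ⊆ A(T) with |F| ≤ k and T ⊛ F S-acyclic; (ii) every arc of T with one endpoint in S₁ and the other in Z' lies in no such set F; and (iii) every arc of T with one endpoint in Z' and the other in S₂ lies in no such set F. -/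

import Mathlib

/-- A tournament on vertex type `V`, given by its arc set `A ⊆ V × V`:
no self-loops, and between any two distinct vertices exactly one arc. -/
def IsTournament {V : Type*} (A : Set (V × V)) : Prop :=
  (∀ v : V, (v, v) ∉ A) ∧ ∀ u v : V, u ≠ v → ((u, v) ∈ A ↔ (v, u) ∉ A)

/-- `f : ZMod n → V` describes a directed cycle (on exactly `n` distinct
vertices) in the digraph with arc set `A`. -/
def IsCycle {V : Type*} (A : Set (V × V)) (n : ℕ) (f : ZMod n → V) : Prop :=
  2 ≤ n ∧ Function.Injective f ∧ ∀ i : ZMod n, (f i, f (i + 1)) ∈ A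

/-- The digraph with arc set `A` has a directed cycle containing a vertex of `S`. -/
def HasSCycle {V : Type*} (A : Set (V × V)) (S : Set V) : Prop :=
  ∃ (n : ℕ) (f : ZMod n → V), IsCycle A n f ∧ ∃ i, f i ∈ S

/-- The digraph with arc set `A` is `S`-acyclic: it has no `S`-cycle. -/
def SAcyclic {V : Type*} (A : Set (V × V)) (S : Set V) : Prop :=
  ¬ HasSCycle A S

/-- The arc set obtained from `A` by reversing all arcs of `F`:
`(A ∪ rev F) \ F` where `rev F = {(u,v) : (v,u) ∈ F}`. -/
def revArcs {V : Type*} (A F : Set (V × V)) : Set (V × V) :=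
  (A ∪ {p | (p.2, p.1) ∈ F}) \ F

/-- `u, v, w` form an `S`-triangle containing the arc `(u,v)`: the three arcs
`(u,v), (v,w), (w,u)` are present and one of the vertices is in `S`.
The `S`-triangles containing the arc `(u,v)` are in bijection with such
third vertices `w`. -/
def IsSTriThrough {V : Type*} (A : Set (V × V)) (S : Set V) (u v w : V) : Prop :=
  (u, v) ∈ A ∧ (v, w) ∈ A ∧ (w, u) ∈ A ∧ (u ∈ S ∨ v ∈ S ∨ w ∈ S)

/-- An arc `p` lies in no set `F ⊆ A` with `|F| ≤ k` whose reversal makes the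
digraph `S`-acyclic (a "sure arc"). -/
def SureArc {V : Type*} (A : Set (V × V)) (S : Set V) (k : ℕ) (p : V × V) :
    Prop :=
  ∀ F ⊆ A, F.ncard ≤ k → SAcyclic (revArcs A F) S → p ∉ F

theorem IsTournament.ne_of_mem {V : Type*} {A : Set (V × V)} (hT : IsTournament A) {u v : V}
    (h : (u, v) ∈ A) : u ≠ v := by
  rintro rfl
  exact hT.1 u h

theorem IsTournament.swap_notMem {V : Type*} {A : Set (V × V)} (hT : IsTournament A) {u v : V}
    (h : (u, v) ∈ A) : (v, u) ∉ A :=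
  (hT.2 u v (hT.ne_of_mem h)).1 h

theorem hasSCycle_of_triangle {V : Type*} {A : Set (V × V)} {S : Set V} {x y z : V}
    (hxy : (x, y) ∈ A) (hyz : (y, z) ∈ A) (hzx : (z, x) ∈ A)
    (nxy : x ≠ y) (nyz : y ≠ z) (nzx : z ≠ x) (hS : x ∈ S ∨ y ∈ S) : HasSCycle A S := by
  refine ⟨3, (![x, y, z] : Fin 3 → V), ⟨by norm_num, ?_, ?_⟩, ?_⟩
  · change Function.Injective (![x, y, z] : Fin 3 → V)
    intro i j h
    fin_cases i <;> fin_cases j <;> simp_all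
  · change ∀ i : Fin 3, ((![x, y, z] : Fin 3 → V) i, (![x, y, z] : Fin 3 → V) (i + 1)) ∈ A
    intro i
    fin_cases i
    exacts [hxy, hyz, hzx]
  · rcases hS with h | h
    exacts [⟨(0 : Fin 3), h⟩, ⟨(1 : Fin 3), h⟩]

/-- An arc `(x, y)` meeting `S` is sure if more than `k` directed paths `x → w → y` exist:
these are arc-disjoint, so one of them avoids `F` and closes an `S`-triangle with `(y, x)`. -/
theorem sureArc_of_paths {V : Type*} [Finite V] {A : Set (V × V)} (hT : IsTournament A)
    {S : Set V} {k : ℕ} {x y : V} (hS : x ∈ S ∨ y ∈ S) {W : Set V} (hW : k < W.ncard)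
    (hx : ∀ w ∈ W, (x, w) ∈ A) (hy : ∀ w ∈ W, (w, y) ∈ A) : SureArc A S k (x, y) := by
  classical
  intro F hF hcard hacyc hp
  obtain ⟨w, hw, hxw, hwy⟩ : ∃ w ∈ W, (x, w) ∉ F ∧ (w, y) ∉ F := by
    by_contra! hcon
    refine absurd (hcard.trans_lt hW) (not_lt.2 ?_)
    refine Set.ncard_le_ncard_of_injOn (fun w => if (x, w) ∈ F then (x, w) else (w, y))
      (fun w hw => ?_) (fun w hw w' hw' h => ?_) F.toFinite
    · by_cases h : (x, w) ∈ F
      · simp [h]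
      · simpa [h] using hcon w hw h
    · have := hT.ne_of_mem (hy w hw)
      have := hT.ne_of_mem (hy w' hw')
      dsimp only at h
      split_ifs at h <;> simp_all
  have hyx : (y, x) ∉ F := fun h => hT.swap_notMem (hF hp) (hF h)
  exact hacyc (hasSCycle_of_triangle (x := y) (y := x) (z := w)
    ⟨Or.inr hp, hyx⟩ ⟨Or.inl (hx w hw), hxw⟩ ⟨Or.inl (hy w hw), hwy⟩
    (hT.ne_of_mem (hF hp)).symm (hT.ne_of_mem (hx w hw)) (hT.ne_of_mem (hy w hw)) hS.symm)

/-- with `S₂ = S \ S₁`, `Z = {v ∉ S : Type(v) = S₁}` of size at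
least `6k + 6`, no arc in more than `k` distinct `S`-triangles, and `Z'` the
vertices of `Z` with at least `k+1` in- and out-neighbors in `Z`:
(i) every arc between `S₁` and `S₂` goes from `S₁` to `S₂` and is a sure arc;
(ii) every arc between `S₁` and `Z'` is a sure arc;
(iii) every arc between `Z'` and `S₂` is a sure arc. -/
theorem stmt_18 {V : Type*} [Fintype V] (A : Set (V × V)) (hT : IsTournament A)
    (S : Set V) (k : ℕ)
    (hfew : ∀ u v : V, (u, v) ∈ A → {w | IsSTriThrough A S u v w}.ncard ≤ k)
    (S₁ : Set V) (hS₁ : S₁ ⊆ S) (S₂ : Set V) (hS₂ : S₂ = S \ S₁)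
    (Z Z' : Set V)
    (hZ : Z = {v | v ∉ S ∧ {s ∈ S | (s, v) ∈ A} = S₁})
    (hZbig : 6 * k + 6 ≤ Z.ncard)
    (hZ' : Z' = {v ∈ Z | k + 1 ≤ {u ∈ Z | (u, v) ∈ A}.ncard ∧
      k + 1 ≤ {u ∈ Z | (v, u) ∈ A}.ncard}) :
    ((∀ a ∈ S₁, ∀ b ∈ S₂, (b, a) ∉ A) ∧
        (∀ p ∈ A, p.1 ∈ S₁ → p.2 ∈ S₂ → SureArc A S k p)) ∧
      (∀ p ∈ A, (p.1 ∈ S₁ ∧ p.2 ∈ Z') ∨ (p.1 ∈ Z' ∧ p.2 ∈ S₁) →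
        SureArc A S k p) ∧
      (∀ p ∈ A, (p.1 ∈ Z' ∧ p.2 ∈ S₂) ∨ (p.1 ∈ S₂ ∧ p.2 ∈ Z') →
        SureArc A S k p) := by
  have hin : ∀ a ∈ S₁, ∀ z ∈ Z, (a, z) ∈ A := by
    intro a ha z hz
    rw [hZ] at hz
    rw [← hz.2] at ha
    exact ha.2
  have hout : ∀ z ∈ Z, ∀ b ∈ S₂, (z, b) ∈ A := by
    intro z hz b hb
    rw [hZ] at hz
    rw [hS₂] at hb
    refine (hT.2 z b ?_).2 fun h => hb.2 ?_
    · rintro rfl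
      exact hz.1 hb.1
    · rw [← hz.2]
      exact ⟨hb.1, h⟩
  have hS₂S : S₂ ⊆ S := hS₂ ▸ Set.sdiff_subset
  have hZ'Z : Z' ⊆ Z := hZ' ▸ Set.sep_subset _ _
  refine ⟨⟨fun a ha b hb hba => ?_, ?_⟩, ?_, ?_⟩
  · have hsub : Z ⊆ {w | IsSTriThrough A S b a w} := fun z hz =>
      ⟨hba, hin a ha z hz, hout z hz b hb, Or.inl (hS₂S hb)⟩
    have := Set.ncard_le_ncard hsub (Set.toFinite _)
    have := hfew b a hba
    omega
  · rintro ⟨a, b⟩ - ha hb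
    exact sureArc_of_paths hT (Or.inl (hS₁ ha)) (W := Z) (by omega) (hin a ha)
      (fun z hz => hout z hz b hb)
  · rintro ⟨a, v⟩ hp (⟨ha, hv⟩ | ⟨ha, hv⟩)
    · have hv' := hv
      rw [hZ'] at hv'
      exact sureArc_of_paths hT (Or.inl (hS₁ ha)) hv'.2.1
        (fun u hu => hin a ha u hu.1) (fun u hu => hu.2)
    · exact absurd hp (hT.swap_notMem (hin v hv a (hZ'Z ha)))
  · rintro ⟨v, b⟩ hp (⟨hv, hb⟩ | ⟨hv, hb⟩)
    · have hv' := hv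
      rw [hZ'] at hv'
      exact sureArc_of_paths hT (Or.inr (hS₂S hb)) hv'.2.2
        (fun u hu => hu.2) (fun u hu => hout u hu.1 b hb)
    · exact absurd hp (hT.swap_notMem (hout b (hZ'Z hb) v hv))
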